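/- Fix λ ∈ (0,1/2), a cutoff ζ, γ ∈ [0,1), K satisfying the standing assumptions, ρ ∈ (γ,1), β = 1/(ρ−γ). There exists R₀* such that for all R₀ ≥ R₀* and all δ with 0 < δ < ρ−γ the following holds: if h₀ ∈ 𝒳_ρ satisfies R^{ρ−1}∫_{[0,R]} dh₀ ≤ 1 and R^{ρ−1}∫_{[0,R]} dh₀ ≥ (1 − (R₀/R)^δ)₊ for all R > 0, then h(·,t) = S_λ(t)h₀ satisfies ∫_{[0,R]} h(x,t) dx ≥ R^{1−ρ}(1 − (R₀/R)^δ)₊ for all R > 0 and all t ≥ 0. -/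

import Mathlib

open MeasureTheory Real Set Filter Topology

noncomputable section

namespace Smol

/-- Standing assumptions on the coagulation kernel `K`: continuity on `(0,∞)²`, symmetry,
nonnegativity, homogeneity of degree `γ` and the growth bound `K(x,y) ≤ C(x^γ + y^γ)`. -/
structure KernelHyp (K : ℝ → ℝ → ℝ) (γ C : ℝ) : Prop where
  cont : ContinuousOn (fun p : ℝ × ℝ => K p.1 p.2) (Ioi (0:ℝ) ×ˢ Ioi (0:ℝ))
  symm : ∀ x y : ℝ, 0 < x → 0 < y → K x y = K y x
  nonneg : ∀ x y : ℝ, 0 < x → 0 < y → 0 ≤ K x y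
  homog : ∀ a x y : ℝ, 0 < a → 0 < x → 0 < y → K (a * x) (a * y) = a ^ γ * K x y
  growth : ∀ x y : ℝ, 0 < x → 0 < y → K x y ≤ C * (x ^ γ + y ^ γ)

/-- A smooth monotone cutoff `ζ`, vanishing on `[0,1/2]` and equal to `1` on `[1,∞)`. -/
structure CutoffHyp (ζ : ℝ → ℝ) : Prop where
  smooth : ContDiffOn ℝ (⊤ : ℕ∞) ζ (Ici (0:ℝ))
  mono : MonotoneOn ζ (Ici (0:ℝ))
  zero : ∀ s : ℝ, s ≤ 1/2 → ζ s = 0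
  one : ∀ s : ℝ, 1 ≤ s → ζ s = 1

/-- The regularized kernel `K_λ`. -/
def Kreg (K : ℝ → ℝ → ℝ) (ζ : ℝ → ℝ) (lam : ℝ) (y z : ℝ) : ℝ :=
  K y z * ζ (y / lam) * ζ (z / lam) * ζ (y / (lam * (y + z))) * ζ (z / (lam * (y + z)))

/-- Membership in the space `𝒳_ρ` of nonnegative Radon measures on `[0,∞)` with
`sup_{R>0} (∫_{[0,R]} dh)/R^{1-ρ} < ∞`. -/
def MemX (ρ : ℝ) (μ : Measure ℝ) : Prop :=
  μ (Iio 0) = 0 ∧ ∃ M : ℝ, ∀ R > (0:ℝ), μ (Icc 0 R) ≤ ENNReal.ofReal (M * R ^ (1 - ρ))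

/-- The norm `‖h‖_{𝒳_ρ} = sup_{R>0} (∫_{[0,R]} dh)/R^{1-ρ}`, expressed as the least
admissible constant. -/
def Xnorm (ρ : ℝ) (μ : Measure ℝ) : ℝ :=
  sInf {M : ℝ | 0 ≤ M ∧ ∀ R > (0:ℝ), μ (Icc 0 R) ≤ ENNReal.ofReal (M * R ^ (1 - ρ))}

/-- The operator `𝒜[H](X,t) = ∫_0^∞ K_λ(Xe^{-βt},Ze^{-βt})/Z dH(Z,t) - βρ`. -/
def Acal (Kl : ℝ → ℝ → ℝ) (β ρ : ℝ) (H : ℝ → Measure ℝ) (X t : ℝ) : ℝ :=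
  (∫ Z, Kl (X * exp (-(β * t))) (Z * exp (-(β * t))) / Z ∂(H t)) - β * ρ

/-- The measure `𝒬[H](·,t)`, i.e. the weighted convolution
`𝒬[H](X,t) = ∫_0^X (K_λ(Ye^{-βt},(X-Y)e^{-βt})/(X-Y)) H(X-Y,t) dH(Y,t)`. -/
def Qcal (Kl : ℝ → ℝ → ℝ) (β : ℝ) (H : ℝ → Measure ℝ) (t : ℝ) : Measure ℝ :=
  Measure.map (fun p : ℝ × ℝ => p.1 + p.2)
    (((H t).prod (H t)).withDensity fun p =>
      ENNReal.ofReal (Kl (p.1 * exp (-(β * t))) (p.2 * exp (-(β * t))) / p.2))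

/-- Mild solution on `[0,T]` of the regularized problem, in the sense of measures:
`H(·,t) = h₀ e^{-∫_0^t 𝒜[H] ds} + ∫_0^t e^{-∫_s^t 𝒜[H] dξ} 𝒬[H](·,s) ds`,
together with membership in `C([0,T];𝒳_ρ)` (weak continuity in time). -/
def IsMildSolution (Kl : ℝ → ℝ → ℝ) (β ρ T : ℝ) (h0 : Measure ℝ)
    (H : ℝ → Measure ℝ) : Prop :=
  (∀ t ∈ Icc (0:ℝ) T, MemX ρ (H t)) ∧
  (∀ φ : ℝ → ℝ, Continuous φ → HasCompactSupport φ →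
      ContinuousOn (fun t => ∫ X, φ X ∂(H t)) (Icc (0:ℝ) T)) ∧
  (∀ t ∈ Icc (0:ℝ) T, ∀ φ : ℝ → ℝ, Continuous φ → HasCompactSupport φ →
      ∫ X, φ X ∂(H t)
        = (∫ X, φ X * exp (-(∫ s in (0:ℝ)..t, Acal Kl β ρ H X s)) ∂h0)
          + ∫ s in (0:ℝ)..t,
              ∫ X, φ X * exp (-(∫ ξ in s..t, Acal Kl β ρ H X ξ)) ∂(Qcal Kl β H s))

/-- The change of variables producing `h(·,t)` from `H(·,t)`:
`h(x,t) = H(xe^{βt},t)` as densities, i.e. `h(·,t) = e^{-βt}·(X ↦ Xe^{-βt})_*H(·,t)`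
as measures; `S_λ(t)h₀` is `Smap β t (H t)` for the mild solution `H` with datum `h₀`. -/
def Smap (β t : ℝ) (ν : Measure ℝ) : Measure ℝ :=
  ENNReal.ofReal (exp (-(β * t))) • Measure.map (fun X => X * exp (-(β * t))) ν

/-- Weakly continuous families of measures integrate jointly continuous integrands with locally
uniformly compact support continuously in the parameters. -/
theorem continuous_integral_of_weaklyContinuous {P : Type*} [TopologicalSpace P]
    {ν : ℝ → Measure ℝ} [∀ t, IsFiniteMeasureOnCompacts (ν t)]
    (hν : ∀ φ : ℝ → ℝ, Continuous φ → HasCompactSupport φ → Continuous fun t => ∫ x, φ x ∂(ν t))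
    {τ : P → ℝ} (hτ : Continuous τ) {g : P → ℝ → ℝ} (hg : Continuous (Function.uncurry g))
    (hsupp : ∀ p₀, ∃ S : Set ℝ, IsCompact S ∧ ∀ᶠ p in 𝓝 p₀, ∀ x ∉ S, g p x = 0) :
    Continuous fun p => ∫ x, g p x ∂(ν (τ p)) := by
  rw [continuous_iff_continuousAt]
  intro p₀
  obtain ⟨S, hS, hgS⟩ := hsupp p₀
  have hg_slice (p : P) : Continuous (g p) := hg.comp (by fun_prop : Continuous fun x => (p, x))
  have hg₀ : ∀ x ∉ S, g p₀ x = 0 := hgS.self_of_nhds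
  have hcpt {p : P} (hp : ∀ x ∉ S, g p x = 0) : HasCompactSupport (g p) :=
    HasCompactSupport.intro hS hp
  obtain ⟨χ, hχ1, -, hχc, hχ01⟩ :=
    exists_continuous_one_zero_of_isCompact hS isClosed_empty (disjoint_empty S)
  have hχν : Continuous fun t => ∫ x, χ x ∂(ν t) := hν _ χ.continuous hχc
  have h₀ : Tendsto (fun p => ∫ x, g p₀ x ∂(ν (τ p))) (𝓝 p₀) (𝓝 (∫ x, g p₀ x ∂(ν (τ p₀)))) :=
    ((hν _ (hg_slice p₀) (hcpt hg₀)).comp hτ).tendsto p₀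
  have hdiff : Tendsto (fun p => (∫ x, g p x ∂(ν (τ p))) - ∫ x, g p₀ x ∂(ν (τ p)))
      (𝓝 p₀) (𝓝 0) := by
    rw [Metric.tendsto_nhds]
    intro ε hε
    set M := (∫ x, χ x ∂(ν (τ p₀))) + 1
    have hM0 : 0 ≤ ∫ x, χ x ∂(ν (τ p₀)) := integral_nonneg fun x => (hχ01 x).1
    have hM : 0 < M := by positivity
    have hbound : ∀ᶠ p in 𝓝 p₀, ∫ x, χ x ∂(ν (τ p)) < M :=
      ((hχν.comp hτ).tendsto p₀).eventually_lt_const (lt_add_one _)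
    have hclose : ∀ᶠ p in 𝓝 p₀, ∀ x ∈ S, |g p x - g p₀ x| < ε / (2 * M) := by
      refine hS.eventually_forall_of_forall_eventually fun x _ => ?_
      have hc : Continuous fun z : P × ℝ => |g z.1 z.2 - g p₀ z.2| :=
        (hg.sub ((hg_slice p₀).comp continuous_snd)).abs
      refine (hc.tendsto (p₀, x)).eventually_lt_const ?_
      simp only [sub_self, abs_zero]
      positivity
    filter_upwards [hgS, hbound, hclose] with p hp hpM hpε
    rw [dist_zero_right, ← integral_sub
      ((hg_slice p).integrable_of_hasCompactSupport (hcpt hp))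
      ((hg_slice p₀).integrable_of_hasCompactSupport (hcpt hg₀))]
    have hle : ‖∫ x, (g p x - g p₀ x) ∂(ν (τ p))‖ ≤ ∫ x, ε / (2 * M) * χ x ∂(ν (τ p)) := by
      refine norm_integral_le_of_norm_le
        ((χ.continuous.integrable_of_hasCompactSupport hχc).const_mul _)
        (Eventually.of_forall fun x => ?_)
      by_cases hx : x ∈ S
      · rw [hχ1 hx, Real.norm_eq_abs]
        simpa using (hpε x hx).le
      · rw [hp x hx, hg₀ x hx, sub_self, norm_zero]
        exact mul_nonneg (by positivity) (hχ01 x).1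
    refine hle.trans_lt ?_
    rw [integral_const_mul]
    calc ε / (2 * M) * ∫ x, χ x ∂(ν (τ p)) ≤ ε / (2 * M) * M := by gcongr
      _ = ε / 2 := by field_simp
      _ < ε := by linarith
  simpa [ContinuousAt] using hdiff.add h₀

/-- A family of measures given by a Duhamel formula has weak right derivative `-A ν + Q`. -/
theorem hasDerivWithinAt_integral_of_duhamel {ν Q : ℝ → Measure ℝ} {μ : Measure ℝ}
    [∀ t, IsFiniteMeasureOnCompacts (ν t)] {A : ℝ → ℝ → ℝ} (hA : Continuous (Function.uncurry A))
    (hQ : ∀ ψ : ℝ × ℝ → ℝ → ℝ, Continuous (Function.uncurry ψ) →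
      (∃ S : Set ℝ, IsCompact S ∧ ∀ p, ∀ x ∉ S, ψ p x = 0) →
      Continuous fun p => ∫ x, ψ p x ∂(Q p.1))
    (hmild : ∀ t ≥ (0 : ℝ), ∀ φ : ℝ → ℝ, Continuous φ → HasCompactSupport φ →
      ∫ x, φ x ∂(ν t) = (∫ x, φ x * exp (-(∫ s in (0 : ℝ)..t, A x s)) ∂μ)
        + ∫ s in (0 : ℝ)..t, ∫ x, φ x * exp (-(∫ ξ in s..t, A x ξ)) ∂(Q s))
    {φ : ℝ → ℝ} (hφ : Continuous φ) (hφc : HasCompactSupport φ) {s : ℝ} (hs : 0 ≤ s) :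
    HasDerivWithinAt (fun t => ∫ x, φ x ∂(ν t))
      ((∫ x, φ x * -A x s ∂(ν s)) + ∫ x, φ x ∂(Q s)) (Ici s) s := by
  have hAx (x : ℝ) : Continuous (A x) := hA.comp (by fun_prop : Continuous fun t => (x, t))
  have hAint (x a b : ℝ) : IntervalIntegrable (A x) volume a b := (hAx x).intervalIntegrable a b
  set E : ℝ → ℝ → ℝ → ℝ := fun r t x => exp (-(∫ ξ in r..t, A x ξ)) with hE
  have hEcont : Continuous fun p : ℝ × ℝ × ℝ => E p.1 p.2.1 p.2.2 := by
    have hprim : Continuous fun p : ℝ × ℝ => ∫ ξ in (0 : ℝ)..p.2, A p.1 ξ :=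
      intervalIntegral.continuous_parametric_primitive_of_continuous hA
    have : ∀ p : ℝ × ℝ × ℝ, E p.1 p.2.1 p.2.2 =
        exp (-((∫ ξ in (0 : ℝ)..p.2.1, A p.2.2 ξ) - ∫ ξ in (0 : ℝ)..p.1, A p.2.2 ξ)) := by
      intro p
      rw [hE, intervalIntegral.integral_interval_sub_left (hAint _ _ _) (hAint _ _ _)]
    simp_rw [this]
    have h1 := hprim.comp (by fun_prop : Continuous fun p : ℝ × ℝ × ℝ => (p.2.2, p.2.1))
    have h2 := hprim.comp (by fun_prop : Continuous fun p : ℝ × ℝ × ℝ => (p.2.2, p.1))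
    exact (h1.sub h2).neg.rexp
  have hEslice (r t : ℝ) : Continuous (E r t) :=
    hEcont.comp (by fun_prop : Continuous fun x : ℝ => (r, t, x))
  have hEmul (a b c x : ℝ) : E b c x * E a b x = E a c x := by
    simp only [hE]
    rw [← exp_add, ← intervalIntegral.integral_add_adjacent_intervals (hAint x a b) (hAint x b c)]
    ring_nf
  have hEself (t x : ℝ) : E t t x = 1 := by simp [hE]
  have hEderiv (r t x : ℝ) : HasDerivAt (fun t => E r t x) (E r t x * -A x t) t :=
    (intervalIntegral.integral_hasDerivAt_right (hAint x r t)
      (hAx x).stronglyMeasurable.stronglyMeasurableAtFilter (hAx x).continuousAt).neg.exp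
  set q : ℝ → ℝ → ℝ := fun r t => ∫ x, φ x * E r t x ∂(Q r) with hq
  have hφ0 : ∀ x ∉ tsupport φ, φ x = 0 := fun x hx => image_eq_zero_of_notMem_tsupport hx
  have hqcont : Continuous fun p : ℝ × ℝ => q p.1 p.2 := by
    refine hQ (fun p x => φ x * E p.1 p.2 x) ?_ ⟨tsupport φ, hφc, fun p x hx => by simp [hφ0 x hx]⟩
    have := hEcont.comp (by fun_prop : Continuous fun z : (ℝ × ℝ) × ℝ => (z.1.1, z.1.2, z.2))
    exact (hφ.comp continuous_snd).mul this
  have hqint (t a b : ℝ) : IntervalIntegrable (fun r => q r t) volume a b :=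
    (hqcont.comp (by fun_prop : Continuous fun r : ℝ => (r, t))).intervalIntegrable a b
  have hstep : ∀ t ∈ Ici s, ∫ x, φ x ∂(ν t) = (∫ x, φ x * E s t x ∂(ν s)) + ∫ r in s..t, q r t := by
    intro t ht
    rw [hmild t (hs.trans ht) φ hφ hφc,
      hmild s hs (fun x => φ x * E s t x) (hφ.mul (hEslice s t)) hφc.mul_right]
    have h1 (x : ℝ) (r : ℝ) :
        φ x * E s t x * exp (-∫ ξ in r..s, A x ξ) = φ x * E r t x := by
      rw [mul_assoc, ← hEmul r s t x]
    simp_rw [h1]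
    rw [add_assoc, intervalIntegral.integral_add_adjacent_intervals (hqint t 0 s) (hqint t s t)]
  have hder1 : HasDerivAt (fun t => ∫ x, φ x * E s t x ∂(ν s)) (∫ x, φ x * -A x s ∂(ν s)) s := by
    have hGcont : Continuous fun p : ℝ × ℝ => φ p.2 * (E s p.1 p.2 * -A p.2 p.1) := by
      have h1 := hEcont.comp (by fun_prop : Continuous fun p : ℝ × ℝ => (s, p.1, p.2))
      have h2 := hA.comp (by fun_prop : Continuous fun p : ℝ × ℝ => (p.2, p.1))
      exact (hφ.comp continuous_snd).mul (h1.mul h2.neg)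
    obtain ⟨B, hB⟩ := (isCompact_Icc (a := s - 1) (b := s + 1)).prod hφc
      |>.exists_bound_of_continuousOn hGcont.continuousOn
    have hInt (t : ℝ) : Integrable (fun x => φ x * E s t x) (ν s) :=
      (hφ.mul (hEslice s t)).integrable_of_hasCompactSupport hφc.mul_right
    have key := (hasDerivAt_integral_of_dominated_loc_of_deriv_le (μ := ν s) (𝕜 := ℝ)
      (F := fun t x => φ x * E s t x) (F' := fun t x => φ x * (E s t x * -A x t))
      (bound := (tsupport φ).indicator fun _ => B) (x₀ := s) (s := Icc (s - 1) (s + 1))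
      (Icc_mem_nhds (by linarith) (by linarith))
      (Eventually.of_forall fun t => (hInt t).aestronglyMeasurable) (hInt s)
      (hGcont.comp (by fun_prop : Continuous fun x : ℝ => (s, x))).aestronglyMeasurable
      (Eventually.of_forall fun x t ht => ?_)
      ((integrable_indicator_iff hφc.isClosed.measurableSet).2
        (integrableOn_const (IsCompact.measure_lt_top hφc).ne))
      (Eventually.of_forall fun x t _ => (hEderiv s t x).const_mul (φ x))).2
    · simpa only [hEself, one_mul] using key
    · by_cases hx : x ∈ tsupport φ
      · rw [indicator_of_mem hx]
        exact hB (t, x) ⟨ht, hx⟩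
      · simp [indicator_of_notMem hx, hφ0 x hx]
  have hder2 : HasDerivAt (fun t => ∫ r in s..t, q r t) (∫ x, φ x ∂(Q s)) s := by
    have hqs : q s s = ∫ x, φ x ∂(Q s) := by simp [hq, hEself]
    rw [← hqs, hasDerivAt_iff_isLittleO, Asymptotics.isLittleO_iff]
    intro ε hε
    have hcl : ∀ᶠ p : ℝ × ℝ in 𝓝 (s, s), ‖q p.1 p.2 - q s s‖ < ε := by
      have hc : Continuous fun p : ℝ × ℝ => ‖q p.1 p.2 - q s s‖ := (hqcont.sub continuous_const).norm
      exact (hc.tendsto (s, s)).eventually_lt_const (by simpa using hε)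
    obtain ⟨η, hη, hball⟩ := Metric.eventually_nhds_iff.1 hcl
    filter_upwards [Metric.ball_mem_nhds s hη] with t ht
    have heq : (∫ r in s..t, q r t) - (∫ r in s..s, q r s) - (t - s) • q s s
        = ∫ r in s..t, (q r t - q s s) := by
      rw [intervalIntegral.integral_sub (hqint t s t) intervalIntegrable_const]
      simp
    rw [heq, Real.norm_eq_abs (t - s)]
    refine intervalIntegral.norm_integral_le_of_norm_le_const fun r hr => ?_
    have hrt : |r - s| ≤ |t - s| := abs_sub_left_of_mem_uIcc (uIoc_subset_uIcc hr)
    rw [Metric.mem_ball, Real.dist_eq] at ht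
    have hdist : dist (r, t) (s, s) < η := by
      rw [Prod.dist_eq, max_lt_iff]
      exact ⟨hrt.trans_lt ht, ht⟩
    exact (hball hdist).le
  exact (hder1.add hder2).hasDerivWithinAt.congr hstep (hstep s self_mem_Ici)

/-- Gronwall's inequality from below, for right derivatives and a variable rate. -/
theorem mul_exp_le_of_rightDeriv_ge {f f' Φ κ : ℝ → ℝ} {t : ℝ} (ht : 0 ≤ t)
    (hf : Continuous f) (hΦ : ∀ s, HasDerivAt Φ (κ s) s)
    (hf' : ∀ s ≥ (0 : ℝ), HasDerivWithinAt f (f' s) (Ici s) s)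
    (hle : ∀ s ≥ (0 : ℝ), κ s * f s ≤ f' s) : f 0 * exp (Φ t - Φ 0) ≤ f t := by
  have hΦc : Continuous Φ := continuous_iff_continuousAt.2 fun s => (hΦ s).continuousAt
  have hder : ∀ s ∈ Ico 0 t, HasDerivWithinAt (fun s => -(f s * exp (-Φ s)))
      (-(f' s * exp (-Φ s) + f s * (exp (-Φ s) * -κ s))) (Ici s) s := fun s hs =>
    ((hf' s hs.1).mul (hΦ s).neg.exp.hasDerivWithinAt).neg
  have key := image_le_of_deriv_right_le_deriv_boundary
    (hf.mul hΦc.neg.rexp).neg.continuousOn hder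
    (B := fun _ => -(f 0 * exp (-Φ 0))) (B' := fun _ => 0) le_rfl continuousOn_const
    (fun s _ => hasDerivWithinAt_const _ _ _) (fun s hs => ?_) (right_mem_Icc.2 ht)
  · have h1 : f 0 * exp (-Φ 0) ≤ f t * exp (-Φ t) := neg_le_neg_iff.1 key
    calc f 0 * exp (Φ t - Φ 0) = f 0 * exp (-Φ 0) * exp (Φ t) := by
          rw [mul_assoc, ← exp_add]; ring_nf
      _ ≤ f t * exp (-Φ t) * exp (Φ t) := by gcongr
      _ = f t := by rw [mul_assoc, ← exp_add]; simp
  · have := mul_le_mul_of_nonneg_right (hle s hs.1) (exp_pos (-Φ s)).le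
    linarith

/-- A continuous nonnegative time-dependent kernel `k t y z` living on positive, comparable
sizes `y` and `z`. -/
structure ComparableKernel (k : ℝ → ℝ → ℝ → ℝ) (L : ℝ) : Prop where
  cont : Continuous fun p : ℝ × ℝ × ℝ => k p.1 p.2.1 p.2.2
  nonneg : ∀ t y z, 0 ≤ k t y z
  pos_left : ∀ {t y z}, k t y z ≠ 0 → 0 < y
  pos_right : ∀ {t y z}, k t y z ≠ 0 → 0 < z
  right_le : ∀ {t y z}, k t y z ≠ 0 → z ≤ L * y

namespace ComparableKernel

variable {k : ℝ → ℝ → ℝ → ℝ} {L : ℝ} {ν : ℝ → Measure ℝ}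

theorem cont_comp (hk : ComparableKernel k L) {P : Type*} [TopologicalSpace P] {f g h : P → ℝ}
    (hf : Continuous f) (hg : Continuous g) (hh : Continuous h) :
    Continuous fun p => k (f p) (g p) (h p) :=
  hk.cont.comp (hf.prodMk (hg.prodMk hh))

/-- The loss rate of a weakly continuous family of measures is continuous. -/
theorem continuous_lossRate (hk : ComparableKernel k L) (hL : 0 ≤ L)
    [∀ t, IsFiniteMeasureOnCompacts (ν t)]
    (hν : ∀ φ : ℝ → ℝ, Continuous φ → HasCompactSupport φ → Continuous fun t => ∫ x, φ x ∂(ν t)) :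
    Continuous fun p : ℝ × ℝ => ∫ z, k p.2 p.1 z ∂(ν p.2) := by
  refine continuous_integral_of_weaklyContinuous hν continuous_snd
    (g := fun p z => k p.2 p.1 z) (hk.cont_comp (by fun_prop) (by fun_prop) (by fun_prop))
    fun p₀ => ⟨Icc 0 (L * (p₀.1 + 1)), isCompact_Icc, ?_⟩
  have hnear : ∀ᶠ p : ℝ × ℝ in 𝓝 p₀, p.1 < p₀.1 + 1 :=
    (continuous_fst.tendsto p₀).eventually_lt_const (lt_add_one _)
  filter_upwards [hnear] with p hp z hz
  by_contra hne
  exact hz ⟨(hk.pos_right hne).le, (hk.right_le hne).trans (by gcongr)⟩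

theorem mem_Icc_of_ne_zero (hk : ComparableKernel k L) {S : Set ℝ} {B : ℝ}
    (hS : S ⊆ Icc (-B) B) {f : ℝ → ℝ} (hf : ∀ x ∉ S, f x = 0) {t y z : ℝ}
    (hne : k t y z * f (y + z) ≠ 0) : y ∈ Icc 0 B ∧ z ∈ Icc 0 B := by
  have hk0 := left_ne_zero_of_mul hne
  have hy := hk.pos_left hk0
  have hz := hk.pos_right hk0
  have hyz : y + z ∈ S := by
    by_contra h
    exact right_ne_zero_of_mul hne (hf _ h)
  have := (hS hyz).2
  exact ⟨⟨hy.le, by linarith⟩, ⟨hz.le, by linarith⟩⟩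

theorem continuous_integral_gain (hk : ComparableKernel k L)
    [∀ t, IsFiniteMeasureOnCompacts (ν t)]
    (hν : ∀ φ : ℝ → ℝ, Continuous φ → HasCompactSupport φ → Continuous fun t => ∫ x, φ x ∂(ν t))
    {P : Type*} [TopologicalSpace P] {τ : P → ℝ} (hτ : Continuous τ) {ψ : P → ℝ → ℝ}
    (hψ : Continuous (Function.uncurry ψ)) {S : Set ℝ} (hS : IsCompact S)
    (hψS : ∀ p, ∀ x ∉ S, ψ p x = 0) :
    Continuous fun p : P × ℝ => ∫ z, k (τ p.1) p.2 z * ψ p.1 (p.2 + z) ∂(ν (τ p.1)) := by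
  obtain ⟨B, hB⟩ := hS.isBounded.subset_closedBall 0
  rw [Real.closedBall_eq_Icc, zero_sub, zero_add] at hB
  refine continuous_integral_of_weaklyContinuous hν (hτ.comp continuous_fst)
    (g := fun p z => k (τ p.1) p.2 z * ψ p.1 (p.2 + z)) ?_
    fun p₀ => ⟨Icc 0 B, isCompact_Icc, Eventually.of_forall fun p z hz => ?_⟩
  · exact (hk.cont_comp (by fun_prop) (by fun_prop) (by fun_prop)).mul
      (hψ.comp (by fun_prop : Continuous fun q : (P × ℝ) × ℝ => (q.1.1, q.1.2 + q.2)))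
  · by_contra hne
    exact hz (hk.mem_Icc_of_ne_zero hB (hψS p.1) hne).2

theorem integral_gain_eq_zero (hk : ComparableKernel k L) {S : Set ℝ} {B : ℝ}
    (hS : S ⊆ Icc (-B) B) {f : ℝ → ℝ} (hf : ∀ x ∉ S, f x = 0) {t y : ℝ} {μ : Measure ℝ}
    (hy : y ∉ Icc 0 B) : ∫ z, k t y z * f (y + z) ∂μ = 0 := by
  have h0 : ∀ z, k t y z * f (y + z) = 0 := fun z => by
    by_contra hne
    exact hy (hk.mem_Icc_of_ne_zero hS hf hne).1
  simp [h0]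

/-- The gain measure integrates test functions as an iterated integral. -/
theorem integral_map_add_withDensity (hk : ComparableKernel k L) {μ : Measure ℝ}
    [IsFiniteMeasureOnCompacts μ] {ψ : ℝ → ℝ} (hψ : Continuous ψ) (hψc : HasCompactSupport ψ)
    (t : ℝ) :
    ∫ x, ψ x ∂(Measure.map (fun p : ℝ × ℝ => p.1 + p.2)
      ((μ.prod μ).withDensity fun p => ENNReal.ofReal (k t p.1 p.2)))
      = ∫ y, ∫ z, k t y z * ψ (y + z) ∂μ ∂μ := by
  have hkc : Continuous fun p : ℝ × ℝ => k t p.1 p.2 :=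
    hk.cont_comp continuous_const continuous_fst continuous_snd
  rw [integral_map (by fun_prop) hψ.aestronglyMeasurable,
    integral_withDensity_eq_integral_toReal_smul hkc.measurable.ennreal_ofReal (by simp)]
  simp only [smul_eq_mul, ENNReal.toReal_ofReal (hk.nonneg _ _ _)]
  obtain ⟨B, hB⟩ := hψc.isBounded.subset_closedBall 0
  rw [Real.closedBall_eq_Icc, zero_sub, zero_add] at hB
  refine integral_prod _ (Continuous.integrable_of_hasCompactSupport
    (hkc.mul (hψ.comp (by fun_prop))) (HasCompactSupport.intro
      ((isCompact_Icc (a := 0) (b := B)).prod (isCompact_Icc (a := 0) (b := B))) fun p hp => ?_))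
  by_contra hne
  exact hp (hk.mem_Icc_of_ne_zero hB (fun x hx => image_eq_zero_of_notMem_tsupport hx) hne)

theorem continuous_integral_gainMeasure (hk : ComparableKernel k L)
    [∀ t, IsFiniteMeasureOnCompacts (ν t)]
    (hν : ∀ φ : ℝ → ℝ, Continuous φ → HasCompactSupport φ → Continuous fun t => ∫ x, φ x ∂(ν t))
    {P : Type*} [TopologicalSpace P] {τ : P → ℝ} (hτ : Continuous τ) {ψ : P → ℝ → ℝ}
    (hψ : Continuous (Function.uncurry ψ)) {S : Set ℝ} (hS : IsCompact S)
    (hψS : ∀ p, ∀ x ∉ S, ψ p x = 0) :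
    Continuous fun p => ∫ x, ψ p x ∂(Measure.map (fun p : ℝ × ℝ => p.1 + p.2)
      (((ν (τ p)).prod (ν (τ p))).withDensity fun q => ENNReal.ofReal (k (τ p) q.1 q.2))) := by
  obtain ⟨B, hB⟩ := hS.isBounded.subset_closedBall 0
  rw [Real.closedBall_eq_Icc, zero_sub, zero_add] at hB
  have hslice (p : P) : Continuous (ψ p) := hψ.comp (by fun_prop : Continuous fun x => (p, x))
  have heq (p : P) := hk.integral_map_add_withDensity (μ := ν (τ p)) (hslice p)
    (HasCompactSupport.intro hS (hψS p)) (τ p)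
  simp_rw [heq]
  exact continuous_integral_of_weaklyContinuous hν hτ
    (hk.continuous_integral_gain hν hτ hψ hS hψS)
    fun p₀ => ⟨Icc 0 B, isCompact_Icc, Eventually.of_forall fun p y hy =>
      hk.integral_gain_eq_zero hB (hψS p) hy⟩

/-- The weak form of the coagulation operator: gain minus loss. -/
theorem integral_coagulation (hk : ComparableKernel k L) (hL : 0 ≤ L) {μ : Measure ℝ}
    [IsFiniteMeasureOnCompacts μ] {φ : ℝ → ℝ} (hφ : Continuous φ) (hφc : HasCompactSupport φ)
    (t c : ℝ) :
    Integrable (fun y => ∫ z, k t y z * (φ y - φ (y + z)) ∂μ) μ ∧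
    (∫ y, φ y * -((∫ z, k t y z ∂μ) - c) ∂μ) +
      ∫ x, φ x ∂(Measure.map (fun p : ℝ × ℝ => p.1 + p.2)
        ((μ.prod μ).withDensity fun q => ENNReal.ofReal (k t q.1 q.2)))
      = c * (∫ y, φ y ∂μ) - ∫ y, ∫ z, k t y z * (φ y - φ (y + z)) ∂μ ∂μ := by
  have hμ : ∀ φ : ℝ → ℝ, Continuous φ → HasCompactSupport φ →
      Continuous fun _ : ℝ => ∫ x, φ x ∂μ := fun _ _ _ => continuous_const
  obtain ⟨B, hB⟩ := hφc.isBounded.subset_closedBall 0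
  rw [Real.closedBall_eq_Icc, zero_sub, zero_add] at hB
  have hφ0 : ∀ x ∉ tsupport φ, φ x = 0 := fun x hx => image_eq_zero_of_notMem_tsupport hx
  have hloss : Continuous fun y => ∫ z, k t y z ∂μ :=
    (hk.continuous_lossRate (ν := fun _ => μ) hL hμ).comp
      (by fun_prop : Continuous fun y : ℝ => (y, t))
  have hgain : Continuous fun y => ∫ z, k t y z * φ (y + z) ∂μ :=
    (hk.continuous_integral_gain (ν := fun _ => μ) hμ (τ := fun _ : ℝ => t) continuous_const
      (ψ := fun _ => φ) (hφ.comp continuous_snd) hφc fun _ => hφ0).comp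
      (by fun_prop : Continuous fun y : ℝ => (t, y))
  have hlossI : Integrable (fun y => φ y * ∫ z, k t y z ∂μ) μ :=
    (hφ.mul hloss).integrable_of_hasCompactSupport hφc.mul_right
  have hgainI : Integrable (fun y => ∫ z, k t y z * φ (y + z) ∂μ) μ :=
    hgain.integrable_of_hasCompactSupport
      (HasCompactSupport.intro isCompact_Icc fun y hy => hk.integral_gain_eq_zero hB hφ0 hy)
  have hsplit (y : ℝ) : ∫ z, k t y z * (φ y - φ (y + z)) ∂μ
      = φ y * (∫ z, k t y z ∂μ) - ∫ z, k t y z * φ (y + z) ∂μ := by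
    have hkc : Continuous fun z => k t y z :=
      hk.cont_comp continuous_const continuous_const continuous_id
    have hkI : Integrable (fun z => k t y z) μ := by
      refine hkc.integrable_of_hasCompactSupport
        (HasCompactSupport.intro (isCompact_Icc (a := 0) (b := L * y)) fun z hz => ?_)
      by_contra hne
      exact hz ⟨(hk.pos_right hne).le, hk.right_le hne⟩
    have hkφI : Integrable (fun z => k t y z * φ (y + z)) μ := by
      refine (hkc.mul (by fun_prop)).integrable_of_hasCompactSupport
        (HasCompactSupport.intro (isCompact_Icc (a := 0) (b := B)) fun z hz => ?_)
      by_contra hne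
      exact hz (hk.mem_Icc_of_ne_zero hB hφ0 hne).2
    rw [← integral_const_mul, ← integral_sub (hkI.const_mul _) hkφI]
    congr with z
    ring
  simp_rw [hsplit]
  refine ⟨hlossI.sub hgainI, ?_⟩
  rw [hk.integral_map_add_withDensity hφ hφc, integral_sub hlossI hgainI]
  have h1 : ∫ y, φ y * -((∫ z, k t y z ∂μ) - c) ∂μ
      = c * (∫ y, φ y ∂μ) - ∫ y, φ y * ∫ z, k t y z ∂μ ∂μ := by
    rw [← integral_const_mul, ← integral_sub
      ((hφ.integrable_of_hasCompactSupport hφc).const_mul c) hlossI]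
    congr with y
    ring
  rw [h1]
  ring

end ComparableKernel

/-- A continuous cutoff equal to `1` on `[0,a]`, vanishing beyond `b`, decreasing on `[0,∞)`. -/
def ramp (a b x : ℝ) : ℝ := max 0 (min (min 1 ((b - x) / (b - a))) (x + 2))

theorem continuous_ramp (a b : ℝ) : Continuous (ramp a b) := by
  unfold ramp; fun_prop

theorem ramp_nonneg (a b x : ℝ) : 0 ≤ ramp a b x := le_max_left _ _

theorem ramp_le_one (a b x : ℝ) : ramp a b x ≤ 1 :=
  max_le zero_le_one ((min_le_left _ _).trans (min_le_left _ _))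

theorem ramp_eq_zero {a b x : ℝ} (hab : a < b) (hx : b ≤ x) : ramp a b x = 0 :=
  max_eq_left ((min_le_left _ _).trans ((min_le_right _ _).trans
    (div_nonpos_of_nonpos_of_nonneg (by linarith) (by linarith))))

theorem ramp_eq_one {a b x : ℝ} (hab : a < b) (h0 : 0 ≤ x) (hx : x ≤ a) : ramp a b x = 1 := by
  have h1 : 1 ≤ (b - x) / (b - a) := by rw [le_div_iff₀ (by linarith)]; linarith
  rw [ramp, min_eq_left h1, min_eq_left (by linarith), max_eq_right zero_le_one]

theorem hasCompactSupport_ramp {a b : ℝ} (hab : a < b) : HasCompactSupport (ramp a b) := by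
  refine HasCompactSupport.intro (isCompact_Icc (a := -2) (b := b)) fun x hx => ?_
  rcases lt_or_ge x (-2) with h | h
  · exact max_eq_left ((min_le_right _ _).trans (by linarith))
  · exact ramp_eq_zero hab (not_le.1 fun h' => hx ⟨h, h'⟩).le

theorem antitoneOn_ramp {a b : ℝ} (hab : a < b) : AntitoneOn (ramp a b) (Ici 0) := by
  intro x hx y hy hxy
  have hx0 : 0 ≤ x := hx
  have hy0 : 0 ≤ y := hy
  have hdrop {u : ℝ} (hu : 0 ≤ u) :
      min (min 1 ((b - u) / (b - a))) (u + 2) = min 1 ((b - u) / (b - a)) :=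
    min_eq_left ((min_le_left _ _).trans (by linarith))
  have hba : 0 < b - a := sub_pos.2 hab
  rw [ramp, ramp, hdrop hx0, hdrop hy0]
  gcongr

theorem integral_ramp_le {a b : ℝ} (hab : a < b) {μ : Measure ℝ} [IsFiniteMeasureOnCompacts μ]
    (hμ : μ (Iio 0) = 0) : ∫ x, ramp a b x ∂μ ≤ μ.real (Icc 0 b) := by
  have hfin : μ (Icc 0 b) ≠ ⊤ := isCompact_Icc.measure_lt_top.ne
  rw [← integral_indicator_one measurableSet_Icc]
  refine integral_mono_ae
    ((continuous_ramp a b).integrable_of_hasCompactSupport (hasCompactSupport_ramp hab))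
    ((integrable_indicator_iff measurableSet_Icc).2 (integrableOn_const hfin)) ?_
  have hae : ∀ᵐ x ∂μ, 0 ≤ x := by
    rw [ae_iff]; simpa [Iio] using hμ
  filter_upwards [hae] with x hx
  by_cases hxb : x ≤ b
  · rw [indicator_of_mem (mem_Icc.2 ⟨hx, hxb⟩)]
    exact ramp_le_one _ _ _
  · rw [ramp_eq_zero hab (not_le.1 hxb).le]
    exact indicator_nonneg (fun _ _ => zero_le_one) _

theorem le_integral_ramp {a b : ℝ} (hab : a < b) {μ : Measure ℝ} [IsFiniteMeasureOnCompacts μ] :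
    μ.real (Icc 0 a) ≤ ∫ x, ramp a b x ∂μ := by
  have hfin : μ (Icc 0 a) ≠ ⊤ := isCompact_Icc.measure_lt_top.ne
  rw [← integral_indicator_one measurableSet_Icc]
  refine integral_mono ((integrable_indicator_iff measurableSet_Icc).2 (integrableOn_const hfin))
    ((continuous_ramp a b).integrable_of_hasCompactSupport (hasCompactSupport_ramp hab))
    fun x => ?_
  by_cases hx : x ∈ Icc 0 a
  · rw [indicator_of_mem hx, ramp_eq_one hab hx.1 hx.2]; rfl
  · rw [indicator_of_notMem hx]; exact ramp_nonneg _ _ _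

theorem CutoffHyp.mem_Icc {ζ : ℝ → ℝ} (hζ : CutoffHyp ζ) (s : ℝ) : ζ s ∈ Icc 0 1 := by
  rcases le_or_gt s (1 / 2) with h | h
  · simp [hζ.zero s h]
  rcases le_or_gt 1 s with h1 | h1
  · simp [hζ.one s h1]
  have hs : s ∈ Ici (0 : ℝ) := mem_Ici.2 (by linarith)
  constructor
  · rw [← hζ.zero 0 (by norm_num)]
    exact hζ.mono (mem_Ici.2 le_rfl) hs (by linarith)
  · rw [← hζ.one 1 le_rfl]
    exact hζ.mono hs (mem_Ici.2 zero_le_one) h1.le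

theorem CutoffHyp.continuousAt {ζ : ℝ → ℝ} (hζ : CutoffHyp ζ) {s : ℝ} (hs : 0 < s) :
    ContinuousAt ζ s :=
  hζ.smooth.continuousOn.continuousAt (Ici_mem_nhds hs)

theorem CutoffHyp.half_lt {ζ : ℝ → ℝ} (hζ : CutoffHyp ζ) {s : ℝ} (hs : ζ s ≠ 0) : 1 / 2 < s :=
  not_le.1 fun h => hs (hζ.zero s h)

/-- The regularized kernel is supported on positive, comparable sizes. -/
theorem Kreg_ne_zero {K : ℝ → ℝ → ℝ} {ζ : ℝ → ℝ} (hζ : CutoffHyp ζ) {lam : ℝ} (hlam : 0 < lam)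
    {y z : ℝ} (hne : Kreg K ζ lam y z ≠ 0) :
    lam / 2 < y ∧ lam / 2 < z ∧ y + z < 2 / lam * y ∧ y + z < 2 / lam * z := by
  simp only [Kreg, mul_ne_zero_iff] at hne
  obtain ⟨⟨⟨⟨-, h1⟩, h2⟩, h3⟩, h4⟩ := hne
  have hy := hζ.half_lt h1
  have hz := hζ.half_lt h2
  have h3 := hζ.half_lt h3
  have h4 := hζ.half_lt h4
  rw [lt_div_iff₀ hlam] at hy hz
  have hsum : 0 < lam * (y + z) := by
    have : 0 < y + z := by linarith
    positivity
  rw [lt_div_iff₀ hsum] at h3 h4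
  refine ⟨by linarith, by linarith, ?_, ?_⟩ <;>
  · rw [div_mul_eq_mul_div, lt_div_iff₀ hlam]
    linarith

theorem Kreg_nonneg {K : ℝ → ℝ → ℝ} {ζ : ℝ → ℝ} {γ C : ℝ} (hK : KernelHyp K γ C)
    (hζ : CutoffHyp ζ) {lam : ℝ} (hlam : 0 < lam) (y z : ℝ) : 0 ≤ Kreg K ζ lam y z := by
  by_cases hne : Kreg K ζ lam y z = 0
  · exact hne.ge
  obtain ⟨hy, hz, -⟩ := Kreg_ne_zero hζ hlam hne
  have := hK.nonneg y z (by linarith) (by linarith)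
  have h (s : ℝ) : 0 ≤ ζ s := (hζ.mem_Icc s).1
  simp only [Kreg]
  have := h (y / lam)
  have := h (z / lam)
  have := h (y / (lam * (y + z)))
  have := h (z / (lam * (y + z)))
  positivity

theorem Kreg_le {K : ℝ → ℝ → ℝ} {ζ : ℝ → ℝ} {γ C : ℝ} (hK : KernelHyp K γ C)
    (hζ : CutoffHyp ζ) {lam y z : ℝ} (hy : 0 < y) (hz : 0 < z) :
    Kreg K ζ lam y z ≤ C * (y ^ γ + z ^ γ) := by
  have hK0 := hK.nonneg y z hy hz
  have hdamp {u : ℝ} (hu : 0 ≤ u) (s : ℝ) : 0 ≤ u * ζ s ∧ u * ζ s ≤ u :=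
    ⟨mul_nonneg hu (hζ.mem_Icc s).1, mul_le_of_le_one_right hu (hζ.mem_Icc s).2⟩
  have h1 := hdamp hK0 (y / lam)
  have h2 := hdamp h1.1 (z / lam)
  have h3 := hdamp h2.1 (y / (lam * (y + z)))
  have h4 := hdamp h3.1 (z / (lam * (y + z)))
  exact h4.2.trans (h3.2.trans (h2.2.trans (h1.2.trans (hK.growth y z hy hz))))

theorem continuousAt_Kreg {K : ℝ → ℝ → ℝ} {ζ : ℝ → ℝ} {γ C : ℝ} (hK : KernelHyp K γ C)
    (hζ : CutoffHyp ζ) {lam y z : ℝ} (hlam : 0 < lam) (hy : 0 < y) (hz : 0 < z) :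
    ContinuousAt (fun p : ℝ × ℝ => Kreg K ζ lam p.1 p.2) (y, z) := by
  have hKc : ContinuousAt (fun p : ℝ × ℝ => K p.1 p.2) (y, z) :=
    hK.cont.continuousAt (prod_mem_nhds (Ioi_mem_nhds hy) (Ioi_mem_nhds hz))
  have hfst : ContinuousAt (fun p : ℝ × ℝ => p.1) (y, z) := continuousAt_fst
  have hsnd : ContinuousAt (fun p : ℝ × ℝ => p.2) (y, z) := continuousAt_snd
  have hsum : 0 < lam * (y + z) := by positivity
  have hden : ContinuousAt (fun p : ℝ × ℝ => lam * (p.1 + p.2)) (y, z) :=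
    continuousAt_const.mul (hfst.add hsnd)
  have hcut {f : ℝ × ℝ → ℝ} (hf : ContinuousAt f (y, z)) (hpos : 0 < f (y, z)) :
      ContinuousAt (fun p => ζ (f p)) (y, z) :=
    ContinuousAt.comp (f := f) (hζ.continuousAt hpos) hf
  exact (((hKc.mul (hcut (hfst.div_const lam) (div_pos hy hlam))).mul
    (hcut (hsnd.div_const lam) (div_pos hz hlam))).mul
    (hcut (hfst.div hden hsum.ne') (div_pos hy hsum))).mul
    (hcut (hsnd.div hden hsum.ne') (div_pos hz hsum))

/-- The rescaled regularized kernel of the equation for `H`. -/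
def rescaledKernel (K : ℝ → ℝ → ℝ) (ζ : ℝ → ℝ) (lam β t y z : ℝ) : ℝ :=
  Kreg K ζ lam (y * exp (-(β * t))) (z * exp (-(β * t))) / z

theorem rescaledKernel_ne_zero {K : ℝ → ℝ → ℝ} {ζ : ℝ → ℝ} (hζ : CutoffHyp ζ) {lam : ℝ}
    (hlam : 0 < lam) {β t y z : ℝ} (hne : rescaledKernel K ζ lam β t y z ≠ 0) :
    0 < y ∧ 0 < z ∧ y + z < 2 / lam * y ∧ y + z < 2 / lam * z := by
  have he := exp_pos (-(β * t))
  obtain ⟨h1, h2, h3, h4⟩ := Kreg_ne_zero hζ hlam (div_ne_zero_iff.1 hne).1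
  have hl : 0 < lam / 2 := by positivity
  rw [← add_mul, ← mul_assoc] at h3 h4
  exact ⟨pos_of_mul_pos_left (hl.trans h1) he.le, pos_of_mul_pos_left (hl.trans h2) he.le,
    lt_of_mul_lt_mul_right h3 he.le, lt_of_mul_lt_mul_right h4 he.le⟩

theorem comparableKernel_rescaledKernel {K : ℝ → ℝ → ℝ} {ζ : ℝ → ℝ} {γ C : ℝ}
    (hK : KernelHyp K γ C) (hζ : CutoffHyp ζ) {lam : ℝ} (hlam : 0 < lam) (β : ℝ) :
    ComparableKernel (rescaledKernel K ζ lam β) (2 / lam) where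
  cont := by
    rw [continuous_iff_continuousAt]
    rintro ⟨t, y, z⟩
    have hvanish {f : ℝ × ℝ × ℝ → ℝ} (hf : Continuous f) (h0 : f (t, y, z) ≤ 0)
        (hz : ∀ p, f p < lam / 2 → rescaledKernel K ζ lam β p.1 p.2.1 p.2.2 = 0) :
        ContinuousAt (fun p : ℝ × ℝ × ℝ => rescaledKernel K ζ lam β p.1 p.2.1 p.2.2)
          (t, y, z) := by
      have hev : ∀ᶠ p in 𝓝 (t, y, z), f p < lam / 2 :=
        (hf.tendsto _).eventually_lt_const (h0.trans_lt (by positivity))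
      refine (continuousAt_const (y := (0 : ℝ))).congr ?_
      filter_upwards [hev] with p hp
      exact (hz p hp).symm
    have he := exp_pos (-(β * t))
    rcases le_or_gt y 0 with hy | hy
    · refine hvanish (f := fun p => p.2.1 * exp (-(β * p.1))) (by fun_prop)
        (mul_nonpos_of_nonpos_of_nonneg hy he.le) fun p hp => ?_
      by_contra hne
      exact hp.not_gt (Kreg_ne_zero hζ hlam (div_ne_zero_iff.1 hne).1).1
    rcases le_or_gt z 0 with hz | hz
    · refine hvanish (f := fun p => p.2.2 * exp (-(β * p.1))) (by fun_prop)
        (mul_nonpos_of_nonpos_of_nonneg hz he.le) fun p hp => ?_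
      by_contra hne
      exact hp.not_gt (Kreg_ne_zero hζ hlam (div_ne_zero_iff.1 hne).1).2.1
    have hmap : Continuous fun p : ℝ × ℝ × ℝ =>
        (p.2.1 * exp (-(β * p.1)), p.2.2 * exp (-(β * p.1))) := by fun_prop
    have hreg : ContinuousAt (fun p : ℝ × ℝ × ℝ =>
        Kreg K ζ lam (p.2.1 * exp (-(β * p.1))) (p.2.2 * exp (-(β * p.1)))) (t, y, z) :=
      ContinuousAt.comp (g := fun p : ℝ × ℝ => Kreg K ζ lam p.1 p.2)
        (f := fun p : ℝ × ℝ × ℝ => (p.2.1 * exp (-(β * p.1)), p.2.2 * exp (-(β * p.1))))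
        (continuousAt_Kreg hK hζ hlam (by positivity) (by positivity)) hmap.continuousAt
    exact hreg.div (by fun_prop) hz.ne'
  nonneg t y z := by
    by_cases hne : rescaledKernel K ζ lam β t y z = 0
    · exact hne.ge
    · exact div_nonneg (Kreg_nonneg hK hζ hlam _ _) (rescaledKernel_ne_zero hζ hlam hne).2.1.le
  pos_left hne := (rescaledKernel_ne_zero hζ hlam hne).1
  pos_right hne := (rescaledKernel_ne_zero hζ hlam hne).2.1
  right_le hne := by
    obtain ⟨h1, h2, h3, -⟩ := rescaledKernel_ne_zero hζ hlam hne
    linarith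

/-- Size of the rescaled kernel for pairs crossing the size `a` from below `b`. -/
theorem rescaledKernel_le {K : ℝ → ℝ → ℝ} {ζ : ℝ → ℝ} {γ C : ℝ} (hγ : 0 ≤ γ) (hC : 0 ≤ C)
    (hK : KernelHyp K γ C) (hζ : CutoffHyp ζ) {lam : ℝ} (hlam : 0 < lam) {β t a b y z : ℝ}
    (hne : rescaledKernel K ζ lam β t y z ≠ 0) (ha : 0 < a) (hyb : y ≤ b) (hayz : a ≤ y + z) :
    rescaledKernel K ζ lam β t y z
      ≤ 2 * C * (2 / lam * b * exp (-(β * t))) ^ γ * (2 / lam / a) := by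
  obtain ⟨hy, hz, h3, h4⟩ := rescaledKernel_ne_zero hζ hlam hne
  have he := exp_pos (-(β * t))
  have hb : 2 / lam * y ≤ 2 / lam * b := by gcongr
  have hbase : 0 ≤ 2 / lam * b := by linarith
  have hpow {u : ℝ} (hu : 0 < u) (hub : u ≤ 2 / lam * b) :
      (u * exp (-(β * t))) ^ γ ≤ (2 / lam * b * exp (-(β * t))) ^ γ := by gcongr
  have hnum : Kreg K ζ lam (y * exp (-(β * t))) (z * exp (-(β * t)))
      ≤ 2 * C * (2 / lam * b * exp (-(β * t))) ^ γ := by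
    calc _ ≤ C * ((y * exp (-(β * t))) ^ γ + (z * exp (-(β * t))) ^ γ) :=
          Kreg_le hK hζ (by positivity) (by positivity)
      _ ≤ C * ((2 / lam * b * exp (-(β * t))) ^ γ + (2 / lam * b * exp (-(β * t))) ^ γ) := by
          gcongr C * (?_ + ?_)
          · exact hpow hy (by linarith)
          · exact hpow hz (by linarith)
      _ = _ := by ring
  have hinv : 1 / z ≤ 2 / lam / a := by
    rw [div_le_div_iff₀ hz ha]; linarith
  calc rescaledKernel K ζ lam β t y z
      = Kreg K ζ lam (y * exp (-(β * t))) (z * exp (-(β * t))) * (1 / z) := by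
        rw [rescaledKernel, div_eq_mul_one_div]
    _ ≤ _ := mul_le_mul hnum hinv (by positivity) (by positivity)

/-- The elementary inequality behind the invariance of the barrier `1 - (R₀/R)^δ` along the
characteristics `R e^{βt}`. -/
theorem barrier_le {α β δ M R₀ R t : ℝ} (hα : 0 < α) (hβ : β * α = 1) (hδ : 0 < δ) (hδα : δ ≤ α)
    (hM : 0 ≤ M) (hR₀ : 0 < R₀) (hMR : M * R₀ ^ (-α) ≤ 1 / 2) (hR : R₀ ≤ R) (ht : 0 ≤ t) :
    1 - (R₀ / R) ^ δ ≤ (1 - (R₀ / (R * exp (β * t))) ^ δ)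
      * exp (-(M * (R * exp (β * t)) ^ (-α) * (exp t - 1))) := by
  have hRpos : 0 < R := hR₀.trans_le hR
  set p := δ / α with hp
  have hp0 : 0 < p := div_pos hδ hα
  have hp1 : p ≤ 1 := (div_le_one hα).2 hδα
  set w := (R₀ / R) ^ α with hw
  have hq0 : 0 < R₀ / R := by positivity
  have hq1 : R₀ / R ≤ 1 := (div_le_one hRpos).2 hR
  have hw0 : 0 < w := rpow_pos_of_pos hq0 _
  have hw1 : w ≤ 1 := rpow_le_one hq0.le hq1 hα.le
  have hu : (R₀ / R) ^ δ = w ^ p := by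
    rw [hw, ← rpow_mul hq0.le, hp, mul_div_cancel₀ _ hα.ne']
  set e := exp (-t) with he
  have he0 : 0 < e := exp_pos _
  have he1 : e ≤ 1 := exp_le_one_iff.2 (by linarith)
  have hαβ : exp (β * t) ^ α = exp t := by
    rw [← exp_mul, show β * t * α = t by linear_combination t * hβ]
  have huv : (R₀ / (R * exp (β * t))) ^ δ = w ^ p * e ^ p := by
    have h1 : R₀ / (R * exp (β * t)) = R₀ / R * (exp (β * t))⁻¹ := by
      field_simp
    have h2 : ((exp (β * t))⁻¹) ^ δ = e ^ p := by
      rw [he, exp_neg, ← hαβ, inv_rpow (exp_pos _).le, inv_rpow (by positivity),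
        ← rpow_mul (exp_pos _).le, hp, mul_div_cancel₀ _ hα.ne']
    rw [h1, mul_rpow hq0.le (by positivity), hu, h2]
  have hrate : M * (R * exp (β * t)) ^ (-α) * (exp t - 1) = M * R₀ ^ (-α) * w * (1 - e) := by
    rw [mul_rpow hRpos.le (exp_pos _).le, rpow_neg (exp_pos _).le, hαβ, hw,
      div_rpow hR₀.le hRpos.le, he, exp_neg, rpow_neg hRpos.le, rpow_neg hR₀.le]
    have := (rpow_pos_of_pos hR₀ α).ne'
    have := (rpow_pos_of_pos hRpos α).ne'
    have := (exp_pos t).ne'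
    field_simp
  rw [hu, huv, hrate]
  set ε := M * R₀ ^ (-α)
  have hε0 : 0 ≤ ε := by positivity
  set u := w ^ p
  set v := e ^ p
  have hu0 : 0 < u := rpow_pos_of_pos hw0 _
  have hu1 : u ≤ 1 := rpow_le_one hw0.le hw1 hp0.le
  have hv0 : 0 < v := rpow_pos_of_pos he0 _
  have hv1 : v ≤ 1 := rpow_le_one he0.le he1 hp0.le
  have hv : p * (1 - e) ≤ 1 - v := by
    have := rpow_one_add_le_one_add_mul_self (s := e - 1) (by linarith) hp0.le hp1
    rw [add_sub_cancel] at this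
    linarith
  have hw' : (1 - u) * w ≤ p * u * (1 - w) := by
    have := rpow_one_add_le_one_add_mul_self (s := w⁻¹ - 1)
      (by have := inv_pos.2 hw0; linarith) hp0.le hp1
    rw [add_sub_cancel, inv_rpow hw0.le, inv_le_iff_one_le_mul₀ hu0] at this
    have h2 := mul_le_mul_of_nonneg_right this hw0.le
    have h3 : (1 + p * (w⁻¹ - 1)) * u * w = u * w + p * u * (1 - w) := by
      field_simp
    linarith
  have hterm : (1 - u) * w * (1 - e) ≤ u * (1 - v) := by
    calc (1 - u) * w * (1 - e) ≤ p * u * (1 - w) * (1 - e) := by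
          apply mul_le_mul_of_nonneg_right hw'; linarith
      _ ≤ p * u * 1 * (1 - e) := by
          have : 0 ≤ 1 - e := by linarith
          gcongr
          linarith
      _ = u * (p * (1 - e)) := by ring
      _ ≤ u * (1 - v) := by gcongr
  have hterm' : u * (1 - v) * (w * (1 - e)) ≤ u * (1 - v) := by
    refine mul_le_of_le_one_right (mul_nonneg hu0.le (by linarith)) ?_
    exact mul_le_one₀ hw1 (by linarith) (by linarith)
  have huv1 : 0 ≤ 1 - u * v := by
    have := mul_le_one₀ hu1 hv0.le hv1
    linarith
  have hexp : 1 - ε * w * (1 - e) ≤ exp (-(ε * w * (1 - e))) := by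
    have := add_one_le_exp (-(ε * w * (1 - e)))
    linarith
  refine le_trans ?_ (mul_le_mul_of_nonneg_left hexp huv1)
  have hsum : (1 - u * v) * (w * (1 - e)) ≤ 2 * (u * (1 - v)) := by
    have : (1 - u * v) * (w * (1 - e))
        = (1 - u) * w * (1 - e) + u * (1 - v) * (w * (1 - e)) := by ring
    linarith
  have hfin : ε * ((1 - u * v) * (w * (1 - e))) ≤ 1 / 2 * (2 * (u * (1 - v))) := by
    have h1 : 0 ≤ u * (1 - v) := mul_nonneg hu0.le (by linarith)
    exact (mul_le_mul_of_nonneg_left hsum hε0).trans (by gcongr)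
  linarith

theorem MemX.isFiniteMeasureOnCompacts {ρ : ℝ} {μ : Measure ℝ} (h : MemX ρ μ) :
    IsFiniteMeasureOnCompacts μ := by
  obtain ⟨h0, M, hM⟩ := h
  refine ⟨fun S hS => ?_⟩
  obtain ⟨B, hB0, hB⟩ := hS.isBounded.subset_closedBall_lt 0 0
  rw [Real.closedBall_eq_Icc, zero_sub, zero_add] at hB
  have hsub : S ⊆ Iio 0 ∪ Icc 0 B := fun x hx =>
    (lt_or_ge x 0).imp id fun h => ⟨h, (hB hx).2⟩
  calc μ S ≤ μ (Iio 0 ∪ Icc 0 B) := measure_mono hsub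
    _ ≤ μ (Iio 0) + μ (Icc 0 B) := measure_union_le _ _
    _ ≤ 0 + ENNReal.ofReal (M * B ^ (1 - ρ)) := add_le_add h0.le (hM B hB0)
    _ < ⊤ := by simp

/-- Mild solutions satisfy the weak form of the coagulation equation with right derivatives. -/
theorem hasDerivWithinAt_integral_of_isMildSolution {K : ℝ → ℝ → ℝ} {ζ : ℝ → ℝ} {γ C β ρ lam : ℝ}
    (hK : KernelHyp K γ C) (hζ : CutoffHyp ζ) (hlam : 0 < lam) {h0 : Measure ℝ}
    {H : ℝ → Measure ℝ} (hH : ∀ T > (0 : ℝ), IsMildSolution (Kreg K ζ lam) β ρ T h0 H)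
    [∀ t, IsFiniteMeasureOnCompacts (H (max t 0))] {φ : ℝ → ℝ} (hφ : Continuous φ)
    (hφc : HasCompactSupport φ) :
    Continuous (fun t => ∫ x, φ x ∂(H (max t 0))) ∧ ∫ x, φ x ∂(H 0) = ∫ x, φ x ∂h0 ∧
    ∀ s ≥ (0 : ℝ), HasDerivWithinAt (fun t => ∫ x, φ x ∂(H (max t 0)))
      (β * ρ * (∫ x, φ x ∂(H s)) -
        ∫ y, ∫ z, rescaledKernel K ζ lam β s y z * (φ y - φ (y + z)) ∂(H s) ∂(H s)) (Ici s) s := by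
  set ν : ℝ → Measure ℝ := fun t => H (max t 0) with hνdef
  have hνH {t : ℝ} (ht : 0 ≤ t) : ν t = H t := by simp [hνdef, ht]
  have hk := comparableKernel_rescaledKernel hK hζ hlam β
  have hL : 0 ≤ 2 / lam := by positivity
  have hν : ∀ φ : ℝ → ℝ, Continuous φ → HasCompactSupport φ →
      Continuous fun t => ∫ x, φ x ∂(ν t) := by
    intro φ hφ hφc
    have hon : ContinuousOn (fun t => ∫ x, φ x ∂(H t)) (Ici 0) := by
      intro t ht
      have ht0 : 0 ≤ t := ht
      refine ((hH (t + 1) (by linarith)).2.1 φ hφ hφc t ⟨ht0, by linarith⟩).mono_of_mem_nhdsWithin ?_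
      rw [← Ici_inter_Iic]
      exact inter_mem self_mem_nhdsWithin (mem_nhdsWithin_of_mem_nhds (Iic_mem_nhds (by linarith)))
    exact hon.comp_continuous (by fun_prop) fun t => mem_Ici.2 (le_max_right t 0)
  have hmild : ∀ t ≥ (0 : ℝ), ∀ φ : ℝ → ℝ, Continuous φ → HasCompactSupport φ →
      ∫ x, φ x ∂(ν t)
        = (∫ x, φ x * exp (-(∫ s in (0 : ℝ)..t, Acal (Kreg K ζ lam) β ρ ν x s)) ∂h0)
        + ∫ s in (0 : ℝ)..t, ∫ x, φ x * exp (-(∫ ξ in s..t, Acal (Kreg K ζ lam) β ρ ν x ξ))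
            ∂(Qcal (Kreg K ζ lam) β ν s) := by
    intro t ht φ hφ hφc
    have hA {a b : ℝ} (ha : 0 ≤ a) (hb : 0 ≤ b) (x : ℝ) :
        ∫ s in a..b, Acal (Kreg K ζ lam) β ρ ν x s = ∫ s in a..b, Acal (Kreg K ζ lam) β ρ H x s := by
      refine intervalIntegral.integral_congr fun s hs => ?_
      simp only [Acal, hνH ((le_min ha hb).trans hs.1)]
    rw [hνH ht, (hH (t + 1) (by linarith)).2.2 t ⟨ht, by linarith⟩ φ hφ hφc]
    congr 1
    · simp_rw [hA le_rfl ht]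
    · refine intervalIntegral.integral_congr fun s hs => ?_
      have hs0 : 0 ≤ s := by
        rw [uIcc_of_le ht] at hs
        exact hs.1
      simp only [hA hs0 ht, Qcal, hνH hs0]
  have hAcont : Continuous (Function.uncurry (Acal (Kreg K ζ lam) β ρ ν)) :=
    (hk.continuous_lossRate hL hν).sub continuous_const
  refine ⟨hν φ hφ hφc, ?_, fun s hs => ?_⟩
  · rw [← hνH le_rfl, hmild 0 le_rfl φ hφ hφc]
    simp
  · have hd := hasDerivWithinAt_integral_of_duhamel (Q := Qcal (Kreg K ζ lam) β ν) hAcont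
      (fun ψ hψ ⟨S, hS, hψS⟩ => hk.continuous_integral_gainMeasure hν continuous_fst hψ hS hψS)
      hmild hφ hφc hs
    rw [← hνH hs]
    exact hd.congr_deriv (hk.integral_coagulation hL hφ hφc s (β * ρ)).2

/-- Coagulation only moves mass out of `[0,X]`, so the mass there grows at rate at most `βρ`. -/
theorem measureReal_Icc_le {K : ℝ → ℝ → ℝ} {ζ : ℝ → ℝ} {γ C β ρ lam : ℝ}
    (hK : KernelHyp K γ C) (hζ : CutoffHyp ζ) (hlam : 0 < lam) {h0 : Measure ℝ}
    {H : ℝ → Measure ℝ} (hH : ∀ T > (0 : ℝ), IsMildSolution (Kreg K ζ lam) β ρ T h0 H)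
    [∀ t, IsFiniteMeasureOnCompacts (H (max t 0))] [IsFiniteMeasureOnCompacts h0]
    (hh0 : h0 (Iio 0) = 0) {a b t : ℝ} (hab : a < b) (ht : 0 ≤ t) :
    (H t).real (Icc 0 a) ≤ exp (β * ρ * t) * h0.real (Icc 0 b) := by
  have hfin {s : ℝ} (hs : 0 ≤ s) : IsFiniteMeasureOnCompacts (H s) := by
    rw [← max_eq_left hs]; infer_instance
  have hk := comparableKernel_rescaledKernel hK hζ hlam β
  obtain ⟨hcont, hinit, hder⟩ := hasDerivWithinAt_integral_of_isMildSolution hK hζ hlam hH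
    (continuous_ramp a b) (hasCompactSupport_ramp hab)
  have key := mul_exp_le_of_rightDeriv_ge (Φ := fun s => β * ρ * s) (κ := fun _ => β * ρ) ht
    hcont.neg (fun s => by simpa using (hasDerivAt_id s).const_mul (β * ρ))
    (fun s hs => (hder s hs).neg) fun s hs => by
      simp only [Pi.neg_apply, max_eq_left hs]
      have hJ : 0 ≤ ∫ y, ∫ z, rescaledKernel K ζ lam β s y z * (ramp a b y - ramp a b (y + z))
          ∂(H s) ∂(H s) := by
        refine integral_nonneg fun y => integral_nonneg fun z => ?_
        by_cases hne : rescaledKernel K ζ lam β s y z = 0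
        · simp [hne]
        have hy := hk.pos_left hne
        have hz := hk.pos_right hne
        exact mul_nonneg (hk.nonneg _ _ _) (sub_nonneg.2 (antitoneOn_ramp hab
          (mem_Ici.2 hy.le) (mem_Ici.2 (by linarith)) (by linarith)))
      linarith
  simp only [Pi.neg_apply, max_self, max_eq_left ht, hinit, mul_zero, sub_zero] at key
  have := hfin ht
  calc (H t).real (Icc 0 a) ≤ ∫ x, ramp a b x ∂(H t) := le_integral_ramp hab
    _ ≤ exp (β * ρ * t) * ∫ x, ramp a b x ∂h0 := by linarith
    _ ≤ _ := by gcongr; exact integral_ramp_le hab hh0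

/-- Bound on the rate at which mass leaves `[0,a]`, in terms of the mass in `[0,(2/λ) b]`. -/
theorem integral_flux_le {K : ℝ → ℝ → ℝ} {ζ : ℝ → ℝ} {γ C : ℝ} (hγ : 0 ≤ γ) (hC : 0 ≤ C)
    (hK : KernelHyp K γ C) (hζ : CutoffHyp ζ) {lam : ℝ} (hlam : 0 < lam) {β t a b : ℝ}
    (ha : 0 < a) (hab : a < b) {μ : Measure ℝ} [IsFiniteMeasureOnCompacts μ] :
    ∫ y, ∫ z, rescaledKernel K ζ lam β t y z * (ramp a b y - ramp a b (y + z)) ∂μ ∂μ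
      ≤ 2 * C * (2 / lam * b * exp (-(β * t))) ^ γ * (2 / lam / a) * μ.real (Icc 0 (2 / lam * b))
        * ∫ y, ramp a b y ∂μ := by
  have hk := comparableKernel_rescaledKernel hK hζ hlam β
  have hb : 0 < b := ha.trans hab
  have hL : 0 < 2 / lam := by positivity
  set c := 2 * C * (2 / lam * b * exp (-(β * t))) ^ γ * (2 / lam / a)
  have hc : 0 ≤ c := by positivity
  have hcpt := hasCompactSupport_ramp hab
  have hfin : μ (Icc 0 (2 / lam * b)) ≠ ⊤ := isCompact_Icc.measure_lt_top.ne
  have hpt (y z : ℝ) : 0 ≤ rescaledKernel K ζ lam β t y z * (ramp a b y - ramp a b (y + z)) ∧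
      rescaledKernel K ζ lam β t y z * (ramp a b y - ramp a b (y + z))
        ≤ (Icc 0 (2 / lam * b)).indicator (fun _ => c * ramp a b y) z := by
    have hr0 : 0 ≤ c * ramp a b y := mul_nonneg hc (ramp_nonneg _ _ _)
    have hind : 0 ≤ (Icc 0 (2 / lam * b)).indicator (fun _ => c * ramp a b y) z :=
      indicator_nonneg (fun _ _ => hr0) _
    by_cases hne : rescaledKernel K ζ lam β t y z = 0
    · simpa [hne] using hind
    have hy := hk.pos_left hne
    have hz := hk.pos_right hne
    refine ⟨mul_nonneg (hk.nonneg _ _ _) (sub_nonneg.2 (antitoneOn_ramp hab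
          (mem_Ici.2 hy.le) (mem_Ici.2 (by linarith)) (by linarith))), ?_⟩
    rcases le_or_gt (y + z) a with hyz | hyz
    · have h0 : ramp a b y - ramp a b (y + z) = 0 := by
        rw [ramp_eq_one hab hy.le (by linarith), ramp_eq_one hab (by linarith) hyz, sub_self]
      rwa [h0, mul_zero]
    rcases le_or_gt b y with hby | hby
    · have h0 : ramp a b y - ramp a b (y + z) = 0 := by
        rw [ramp_eq_zero hab hby, ramp_eq_zero hab (by linarith), sub_self]
      rwa [h0, mul_zero]
    have hzmem : z ∈ Icc 0 (2 / lam * b) := ⟨hz.le, (hk.right_le hne).trans (by gcongr)⟩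
    rw [indicator_of_mem hzmem]
    exact mul_le_mul (rescaledKernel_le hγ hC hK hζ hlam hne ha hby.le hyz.le)
      (sub_le_self _ (ramp_nonneg _ _ _)) (sub_nonneg.2 (antitoneOn_ramp hab
        (mem_Ici.2 hy.le) (mem_Ici.2 (by linarith)) (by linarith))) hc
  have hinner (y : ℝ) :
      ∫ z, rescaledKernel K ζ lam β t y z * (ramp a b y - ramp a b (y + z)) ∂μ
        ≤ c * μ.real (Icc 0 (2 / lam * b)) * ramp a b y := by
    calc _ ≤ ∫ z, (Icc 0 (2 / lam * b)).indicator (fun _ => c * ramp a b y) z ∂μ :=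
          integral_mono_of_nonneg (Eventually.of_forall fun z => (hpt y z).1)
            ((integrable_indicator_iff measurableSet_Icc).2 (integrableOn_const hfin))
            (Eventually.of_forall fun z => (hpt y z).2)
      _ = _ := by
          rw [integral_indicator measurableSet_Icc, setIntegral_const, smul_eq_mul]
          ring
  rw [← integral_const_mul]
  exact integral_mono
    (hk.integral_coagulation hL.le (continuous_ramp a b) hcpt t 0).1
    (((continuous_ramp a b).integrable_of_hasCompactSupport hcpt).const_mul _) hinner

/-- The constant in the exponential lower bound for the mass of `[0,X]`. -/
def fluxConst (γ C ρ lam : ℝ) : ℝ := 4 * C * (2 / lam) * (4 / lam) ^ γ * (4 / lam) ^ (1 - ρ)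

/-- The mass in `[0,b]` is bounded below by its initial value times an explicit exponential. -/
theorem le_measureReal_Icc {K : ℝ → ℝ → ℝ} {ζ : ℝ → ℝ} {γ C β ρ lam : ℝ} (hγ : 0 ≤ γ)
    (hC : 0 ≤ C) (hK : KernelHyp K γ C) (hζ : CutoffHyp ζ) (hρ0 : 0 ≤ ρ) (hρ1 : ρ ≤ 1)
    (hβ : β * (ρ - γ) = 1) (hlam : 0 < lam) {h0 : Measure ℝ}
    {H : ℝ → Measure ℝ} (hH : ∀ T > (0 : ℝ), IsMildSolution (Kreg K ζ lam) β ρ T h0 H)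
    [∀ t, IsFiniteMeasureOnCompacts (H (max t 0))] [IsFiniteMeasureOnCompacts h0]
    (hneg : ∀ t ≥ (0 : ℝ), H t (Iio 0) = 0) (hh0 : h0 (Iio 0) = 0)
    (hup : ∀ R > (0 : ℝ), h0.real (Icc 0 R) ≤ R ^ (1 - ρ))
    {a b t : ℝ} (ha : 0 < a) (hab : a < b) (hba : b ≤ 2 * a) (ht : 0 ≤ t) :
    h0.real (Icc 0 a) *
      exp (β * ρ * t - fluxConst γ C ρ lam * a ^ (-(ρ - γ)) * (exp t - 1))
      ≤ (H t).real (Icc 0 b) := by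
  have hb : 0 < b := ha.trans hab
  have hfin {s : ℝ} (hs : 0 ≤ s) : IsFiniteMeasureOnCompacts (H s) := by
    rw [← max_eq_left hs]; infer_instance
  obtain ⟨hcont, hinit, hder⟩ := hasDerivWithinAt_integral_of_isMildSolution hK hζ hlam hH
    (continuous_ramp a b) (hasCompactSupport_ramp hab)
  set D := fluxConst γ C ρ lam * a ^ (-(ρ - γ))
  have hrate : ∀ s ≥ (0 : ℝ), 2 * C * (2 / lam * b * exp (-(β * s))) ^ γ * (2 / lam / a)
      * (H s).real (Icc 0 (2 / lam * b)) ≤ D * exp s := by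
    intro s hs
    have hbig : 2 / lam * b ≤ 4 / lam * a := by
      calc 2 / lam * b ≤ 2 / lam * (2 * a) := by gcongr
        _ = 4 / lam * a := by ring
    have hX : 0 < 2 / lam * b := by positivity
    have hmass : (H s).real (Icc 0 (2 / lam * b))
        ≤ exp (β * ρ * s) * (2 * (4 / lam * a) ^ (1 - ρ)) := by
      refine (measureReal_Icc_le hK hζ hlam hH hh0 (by linarith :
        2 / lam * b < 2 * (2 / lam * b)) hs).trans ?_
      gcongr
      refine (hup _ (by positivity)).trans ?_
      rw [mul_rpow zero_le_two hX.le]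
      have h2 : (2 : ℝ) ^ (1 - ρ) ≤ 2 := by
        simpa using rpow_le_rpow_of_exponent_le one_le_two (by linarith : 1 - ρ ≤ 1)
      have h3 : (2 / lam * b) ^ (1 - ρ) ≤ (4 / lam * a) ^ (1 - ρ) :=
        rpow_le_rpow hX.le hbig (by linarith)
      gcongr
    have hpow : (2 / lam * b * exp (-(β * s))) ^ γ
        ≤ (4 / lam) ^ γ * a ^ γ * exp (-(β * s)) ^ γ := by
      rw [← mul_rpow (by positivity) ha.le, ← mul_rpow (by positivity) (exp_pos _).le]
      gcongr
    have hsize : a ^ (-(ρ - γ)) = a ^ γ * a ^ (1 - ρ) / a := by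
      rw [← rpow_add ha, ← rpow_sub_one ha.ne']
      ring_nf
    have htime : exp (-(β * s)) ^ γ * exp (β * ρ * s) = exp s := by
      rw [← exp_mul, ← exp_add]
      congr 1
      linear_combination s * hβ
    calc _ ≤ 2 * C * ((4 / lam) ^ γ * a ^ γ * exp (-(β * s)) ^ γ) * (2 / lam / a)
          * (exp (β * ρ * s) * (2 * (4 / lam * a) ^ (1 - ρ))) := by gcongr
      _ = 4 * C * (2 / lam) * (4 / lam) ^ γ * (4 / lam) ^ (1 - ρ) * (a ^ γ * a ^ (1 - ρ) / a)
          * (exp (-(β * s)) ^ γ * exp (β * ρ * s)) := by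
          rw [mul_rpow (by positivity) ha.le]; ring
      _ = D * exp s := by rw [htime, ← hsize]; rfl
  have key := mul_exp_le_of_rightDeriv_ge (Φ := fun s => β * ρ * s - D * exp s)
    (κ := fun s => β * ρ - D * exp s) ht hcont
    (fun s => by
      simpa using ((hasDerivAt_id s).const_mul (β * ρ)).fun_sub ((hasDerivAt_exp s).const_mul D))
    hder fun s hs => by
      simp only [max_eq_left hs]
      have := hfin hs
      have hm : 0 ≤ ∫ y, ramp a b y ∂(H s) := integral_nonneg (ramp_nonneg a b)
      have h1 := integral_flux_le (μ := H s) (β := β) (t := s) hγ hC hK hζ hlam ha hab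
      have h2 := mul_le_mul_of_nonneg_right (hrate s hs) hm
      linarith
  simp only [max_self, max_eq_left ht, hinit] at key
  have := hfin ht
  calc _ ≤ (∫ x, ramp a b x ∂h0) * exp (β * ρ * t - D * (exp t - 1)) := by
        gcongr; exact le_integral_ramp hab
    _ ≤ ∫ x, ramp a b x ∂(H t) := by
        convert key using 3
        simp only [mul_zero, exp_zero]
        ring
    _ ≤ _ := integral_ramp_le hab (hneg t ht)

theorem Smap_Icc (β t : ℝ) (μ : Measure ℝ) (R : ℝ) :
    Smap β t μ (Icc 0 R) = ENNReal.ofReal (exp (-(β * t))) * μ (Icc 0 (R * exp (β * t))) := by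
  have he := exp_pos (-(β * t))
  rw [Smap, Measure.smul_apply, smul_eq_mul, Measure.map_apply (by fun_prop) measurableSet_Icc]
  congr 2
  ext x
  simp only [mem_preimage, mem_Icc]
  refine and_congr ⟨fun h => nonneg_of_mul_nonneg_left h he, fun h => by positivity⟩ ?_
  rw [exp_neg, ← div_eq_mul_inv, div_le_iff₀ (exp_pos _)]

/-- Invariance of the lower bound `∫_{[0,R]} dh ≥ R^{1-ρ}(1-(R₀/R)^δ)₊` under the
regularized evolution, for `R₀` sufficiently large and `0 < δ < ρ-γ`. -/
theorem invariance_of_lower_bound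
    (γ C ρ β lam : ℝ) (K : ℝ → ℝ → ℝ) (ζ : ℝ → ℝ)
    (hγ : γ ∈ Ico (0:ℝ) 1) (hC : 0 < C) (hK : KernelHyp K γ C) (hζ : CutoffHyp ζ)
    (hρ : ρ ∈ Ioo γ 1) (hβ : β = 1 / (ρ - γ)) (hlam : lam ∈ Ioo (0:ℝ) (1/2)) :
    ∃ Rstar : ℝ, 0 < Rstar ∧ ∀ R₀ ≥ Rstar, ∀ δ : ℝ, 0 < δ → δ < ρ - γ →
      ∀ h0 : Measure ℝ, MemX ρ h0 →
      (∀ R > (0:ℝ), h0 (Icc 0 R) ≤ ENNReal.ofReal (R ^ (1 - ρ))) →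
      (∀ R > (0:ℝ),
        ENNReal.ofReal (R ^ (1 - ρ) * max (1 - (R₀ / R) ^ δ) 0) ≤ h0 (Icc 0 R)) →
      ∀ H : ℝ → Measure ℝ,
      (∀ T > (0:ℝ), IsMildSolution (Kreg K ζ lam) β ρ T h0 H) →
      ∀ t ≥ (0:ℝ), ∀ R > (0:ℝ),
        ENNReal.ofReal (R ^ (1 - ρ) * max (1 - (R₀ / R) ^ δ) 0)
          ≤ (Smap β t (H t)) (Icc 0 R) := by
  obtain ⟨hγρ, hρ1⟩ := hρ
  have hlam0 := hlam.1
  have hα : 0 < ρ - γ := sub_pos.2 hγρ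
  have hβα : β * (ρ - γ) = 1 := by rw [hβ]; field_simp
  have hβ0 : 0 < β := by rw [hβ]; positivity
  set M := fluxConst γ C ρ lam with hMdef
  have hM : 0 < M := by rw [hMdef, fluxConst]; positivity
  refine ⟨(2 * M) ^ (ρ - γ)⁻¹, by positivity, ?_⟩
  intro R₀ hR₀ δ hδ hδα h0 hh0 hup hlow H hH t ht R hR
  have hR₀0 : 0 < R₀ := lt_of_lt_of_le (by positivity) hR₀
  rcases lt_or_ge R R₀ with hRR | hRR
  · have h1 : 1 ≤ (R₀ / R) ^ δ := one_le_rpow ((one_le_div hR).2 hRR.le) hδ.le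
    rw [max_eq_right (by linarith)]
    simp
  have hMR : M * R₀ ^ (-(ρ - γ)) ≤ 1 / 2 := by
    have h1 : 2 * M ≤ R₀ ^ (ρ - γ) := by
      have h2 := rpow_le_rpow (by positivity) hR₀ hα.le
      rwa [← rpow_mul (by positivity), inv_mul_cancel₀ hα.ne', rpow_one] at h2
    rw [rpow_neg hR₀0.le, ← div_eq_mul_inv, div_le_iff₀ (by positivity)]
    linarith
  have hmem {s : ℝ} (hs : 0 ≤ s) : MemX ρ (H s) :=
    (hH (s + 1) (by linarith)).1 s ⟨hs, by linarith⟩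
  have hfinH : ∀ s, IsFiniteMeasureOnCompacts (H (max s 0)) := fun s =>
    (hmem (le_max_right s 0)).isFiniteMeasureOnCompacts
  have hfin0 : IsFiniteMeasureOnCompacts h0 := hh0.isFiniteMeasureOnCompacts
  have hfint : H t (Icc 0 (R * exp (β * t))) ≠ ⊤ :=
    haveI := (hmem ht).isFiniteMeasureOnCompacts
    isCompact_Icc.measure_lt_top.ne
  have hup' : ∀ r > (0 : ℝ), h0.real (Icc 0 r) ≤ r ^ (1 - ρ) := fun r hr =>
    ENNReal.toReal_le_of_le_ofReal (by positivity) (hup r hr)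
  have hlow' : ∀ r > (0 : ℝ), r ^ (1 - ρ) * (1 - (R₀ / r) ^ δ) ≤ h0.real (Icc 0 r) := by
    intro r hr
    have hfin : h0 (Icc 0 r) ≠ ⊤ := isCompact_Icc.measure_lt_top.ne
    have h1 := (ENNReal.ofReal_le_iff_le_toReal hfin).1 (hlow r hr)
    refine le_trans ?_ h1
    gcongr
    exact le_max_left _ _
  set X := R * exp (β * t) with hX
  have hX0 : 0 < X := by positivity
  have hmass : X ^ (1 - ρ) * (1 - (R₀ / X) ^ δ)
      * exp (β * ρ * t - M * X ^ (-(ρ - γ)) * (exp t - 1)) ≤ (H t).real (Icc 0 X) := by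
    have hcont : ContinuousAt (fun a : ℝ => a ^ (1 - ρ) * (1 - (R₀ / a) ^ δ)
        * exp (β * ρ * t - M * a ^ (-(ρ - γ)) * (exp t - 1))) X := by
      have hpow (c : ℝ) : ContinuousAt (fun a : ℝ => a ^ c) X :=
        continuousAt_id.rpow_const (Or.inl hX0.ne')
      have hdiv : ContinuousAt (fun a : ℝ => (R₀ / a) ^ δ) X :=
        (continuousAt_const.div continuousAt_id hX0.ne').rpow_const (Or.inr hδ.le)
      exact ((hpow _).mul (continuousAt_const.sub hdiv)).mul
        (continuousAt_const.sub ((continuousAt_const.mul (hpow _)).mul continuousAt_const)).rexp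
    refine le_of_tendsto (hcont.tendsto.mono_left (nhdsWithin_le_nhds (s := Iio X))) ?_
    have hnear : ∀ᶠ a in 𝓝[<] X, X / 2 < a :=
      mem_nhdsWithin_of_mem_nhds (Ioi_mem_nhds (by linarith))
    filter_upwards [hnear, self_mem_nhdsWithin] with a ha haX
    have ha0 : 0 < a := by linarith
    refine le_trans ?_ (le_measureReal_Icc hγ.1 hC.le hK hζ (hγ.1.trans hγρ.le) hρ1.le hβα hlam0 hH
      (fun s hs => (hmem hs).1) hh0.1 hup' ha0 haX (by linarith) ht)
    gcongr
    exact hlow' a ha0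
  have hbar := barrier_le hα hβα hδ hδα.le hM.le hR₀0 hMR hRR ht
  rw [← hX] at hbar
  have hscale : exp (-(β * t)) * X ^ (1 - ρ) * exp (β * ρ * t) = R ^ (1 - ρ) := by
    rw [hX, mul_rpow hR.le (exp_pos _).le, ← exp_mul,
      show exp (-(β * t)) * (R ^ (1 - ρ) * exp (β * t * (1 - ρ))) * exp (β * ρ * t)
        = R ^ (1 - ρ) * (exp (-(β * t)) * exp (β * t * (1 - ρ)) * exp (β * ρ * t)) by ring,
      ← exp_add, ← exp_add,
      show -(β * t) + β * t * (1 - ρ) + β * ρ * t = 0 by ring, exp_zero, mul_one]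
  have hu : (R₀ / R) ^ δ ≤ 1 := rpow_le_one (by positivity) ((div_le_one hR).2 hRR) hδ.le
  rw [Smap_Icc, max_eq_left (by linarith), ← ENNReal.ofReal_toReal hfint,
    ← ENNReal.ofReal_mul (exp_pos _).le]
  refine ENNReal.ofReal_le_ofReal ?_
  calc R ^ (1 - ρ) * (1 - (R₀ / R) ^ δ)
      ≤ R ^ (1 - ρ) * ((1 - (R₀ / X) ^ δ) * exp (-(M * X ^ (-(ρ - γ)) * (exp t - 1)))) := by gcongr
    _ = exp (-(β * t)) * (X ^ (1 - ρ) * (1 - (R₀ / X) ^ δ)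
        * exp (β * ρ * t - M * X ^ (-(ρ - γ)) * (exp t - 1))) := by
        rw [← hscale, sub_eq_add_neg (β * ρ * t), exp_add]
        ring
    _ ≤ exp (-(β * t)) * (H t).real (Icc 0 X) := by gcongr

end Smol
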